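/- Let R be a commutative ring, m ≥ 1, and I₁,…,I_m ideals of R. In R[t] set Kᵢ := Iᵢ·R[t] + (t). Then for all natural numbers n₁,…,n_m: (a) the image of the ideal K₁^{n₁+1}⋯K_m^{n_m+1} under the evaluation ring homomorphism R[t] → R sending t to 0 equals the ideal I₁^{n₁+1}⋯I_m^{n_m+1}; and (b) K₁^{n₁+1}⋯K_m^{n_m+1} ∩ (t) = K₁^{n₁+1}⋯K_m^{n_m+1} ∩ t·(K₁^{n₁}⋯K_m^{n_m}). Consequently, evaluation at t = 0 induces an isomorphism of R-modules K₁^{n₁+1}⋯K_m^{n_m+1} / (K₁^{n₁+1}⋯K_m^{n_m+1} ∩ t·K₁^{n₁}⋯K_m^{n_m}) ≅ I₁^{n₁+1}⋯I_m^{n_m+1}. -/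

import Mathlib

open Polynomial

theorem Ideal.sup_pow_succ_le {S : Type*} [CommRing S] (M T : Ideal S) (n : ℕ) :
    (M ⊔ T) ^ (n + 1) ≤ M ^ (n + 1) ⊔ T * (M ⊔ T) ^ n := by
  induction n with
  | zero => simp
  | succ k ih =>
    rw [pow_succ]
    refine (Ideal.mul_mono_left ih).trans ?_
    rw [Ideal.sup_mul, mul_assoc, ← pow_succ, Ideal.mul_sup, ← pow_succ]
    refine sup_le (sup_le le_sup_left (le_sup_of_le_right ?_)) le_sup_right
    rw [mul_comm]
    exact Ideal.mul_mono_right (Ideal.pow_right_mono le_sup_left _)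

theorem Ideal.prod_sup_pow_succ_le {S ι : Type*} [CommRing S] (s : Finset ι) (M : ι → Ideal S)
    (T : Ideal S) (n : ι → ℕ) :
    ∏ i ∈ s, (M i ⊔ T) ^ (n i + 1) ≤
      (∏ i ∈ s, M i ^ (n i + 1)) ⊔ T * ∏ i ∈ s, (M i ⊔ T) ^ n i := by
  classical
  induction s using Finset.induction_on with
  | empty => simp
  | insert a s ha ih =>
    simp only [Finset.prod_insert ha]
    have hpow : M a ^ (n a + 1) ≤ (M a ⊔ T) ^ n a :=
      (Ideal.pow_le_pow_right (Nat.le_succ _)).trans (Ideal.pow_right_mono le_sup_left _)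
    have hprod : ∏ i ∈ s, (M i ⊔ T) ^ (n i + 1) ≤ ∏ i ∈ s, (M i ⊔ T) ^ n i :=
      Finset.prod_le_prod' fun i _ => Ideal.pow_le_pow_right (Nat.le_succ _)
    refine (Ideal.mul_mono_left (Ideal.sup_pow_succ_le (M a) T (n a))).trans ?_
    rw [Ideal.sup_mul]
    refine sup_le ((Ideal.mul_mono_right ih).trans ?_) ?_
    · rw [Ideal.mul_sup]
      refine sup_le_sup le_rfl ?_
      rw [mul_left_comm]
      exact Ideal.mul_mono_right (Ideal.mul_mono_left hpow)
    · refine le_sup_of_le_right ?_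
      rw [mul_assoc]
      exact Ideal.mul_mono_right (Ideal.mul_mono_right hprod)

theorem Polynomial.mem_span_X_mul_of_eval_zero {R : Type*} [CommRing R] {A : Ideal R}
    {B : Ideal R[X]} (hAB : A.map C ≤ B) {p : R[X]} (hp : p ∈ A.map C ⊔ Ideal.span {X} * B)
    (h0 : p.eval 0 = 0) : p ∈ Ideal.span {X} * B := by
  obtain ⟨a, ha, b, hb, rfl⟩ := Submodule.mem_sup.1 hp
  refine add_mem ?_ hb
  obtain ⟨c, -, rfl⟩ := Ideal.mem_span_singleton_mul.1 hb
  have ha0 : a.coeff 0 = 0 := by simpa [coeff_zero_eq_eval_zero] using h0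
  obtain ⟨q, rfl⟩ := X_dvd_iff.2 ha0
  refine Ideal.mem_span_singleton_mul.2 ⟨q, hAB (Ideal.mem_map_C_iff.2 fun k => ?_), rfl⟩
  simpa [coeff_X_mul] using Ideal.mem_map_C_iff.1 ha (k + 1)

/-- For ideals `I₁,…,I_m` of a commutative ring `R`, set `Kᵢ = Iᵢ·R[t] + (t)` in `R[t]`.
Then (a) the image of `K₁^{n₁+1}⋯K_m^{n_m+1}` under evaluation at `t = 0` is
`I₁^{n₁+1}⋯I_m^{n_m+1}`; (b) `∏ Kᵢ^{nᵢ+1} ∩ (t) = ∏ Kᵢ^{nᵢ+1} ∩ t·(∏ Kᵢ^{nᵢ})`; and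
consequently evaluation at `t = 0` induces an `R`-module isomorphism
`∏ Kᵢ^{nᵢ+1} / (∏ Kᵢ^{nᵢ+1} ∩ t·∏ Kᵢ^{nᵢ}) ≃ ∏ Iᵢ^{nᵢ+1}`. -/
theorem mixed_rees_graded_piece {R : Type*} [CommRing R] (m : ℕ) (hm : 1 ≤ m)
    (I : Fin m → Ideal R) (n : Fin m → ℕ)
    (K : Fin m → Ideal R[X])
    (hK : ∀ i, K i = Ideal.map (C : R →+* R[X]) (I i) ⊔ Ideal.span {X}) :
    Ideal.map (evalRingHom (0 : R)) (∏ i, K i ^ (n i + 1)) = (∏ i, I i ^ (n i + 1)) ∧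
    (∏ i, K i ^ (n i + 1)) ⊓ Ideal.span {(X : R[X])} =
      (∏ i, K i ^ (n i + 1)) ⊓ (Ideal.span {(X : R[X])} * ∏ i, K i ^ (n i)) ∧
    ∃ e : ((Submodule.restrictScalars R (∏ i, K i ^ (n i + 1))) ⧸
        (Submodule.comap (Submodule.restrictScalars R (∏ i, K i ^ (n i + 1))).subtype
          (Submodule.restrictScalars R ((∏ i, K i ^ (n i + 1)) ⊓
            (Ideal.span {(X : R[X])} * ∏ i, K i ^ (n i)))))) ≃ₗ[R]
        ↥(∏ i, I i ^ (n i + 1)),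
      ∀ (p : R[X]) (hp : p ∈ ∏ i, K i ^ (n i + 1)),
        (e (Submodule.Quotient.mk ⟨p, hp⟩) : R) = eval 0 p := by
  obtain rfl : K = fun i => (I i).map C ⊔ Ideal.span {X} := funext hK
  clear hK
  beta_reduce
  set J : Ideal R[X] := ∏ i, ((I i).map C ⊔ Ideal.span {X}) ^ (n i + 1) with hJ
  set B : Ideal R[X] := ∏ i, ((I i).map C ⊔ Ideal.span {X}) ^ n i with hB
  set A : Ideal R := ∏ i, I i ^ (n i + 1) with hA
  have hmapA : A.map (C : R →+* R[X]) = ∏ i, (I i).map C ^ (n i + 1) := by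
    simp only [hA, ← Ideal.mapHom_apply, map_prod, map_pow]
  have hAJ : A.map C ≤ J := by
    rw [hmapA]
    exact Finset.prod_le_prod' fun i _ => Ideal.pow_right_mono le_sup_left _
  have hJB : J ≤ B := Finset.prod_le_prod' fun i _ => Ideal.pow_le_pow_right (Nat.le_succ _)
  have hJle : J ≤ A.map C ⊔ Ideal.span {X} * B := by
    rw [hmapA]
    exact Ideal.prod_sup_pow_succ_le _ _ _ _
  have hX {p : R[X]} (hp : p ∈ J) (h0 : p.eval 0 = 0) : p ∈ Ideal.span {X} * B :=
    mem_span_X_mul_of_eval_zero (hAJ.trans hJB) (hJle hp) h0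
  have heval {p : R[X]} (hp : p ∈ Ideal.span {(X : R[X])}) : p.eval 0 = 0 := by
    obtain ⟨q, rfl⟩ := Ideal.mem_span_singleton.1 hp
    simp
  have hmap : J.map (evalRingHom (0 : R)) = A := by
    have hC : (evalRingHom (0 : R)).comp C = RingHom.id R := by ext; simp
    simp only [hJ, hA, ← Ideal.mapHom_apply, map_prod, map_pow]
    simp [Ideal.map_sup, Ideal.map_map, hC, Ideal.map_span]
  refine ⟨hmap, le_antisymm ?_ (inf_le_inf_left _ Ideal.mul_le_left), ?_⟩
  · exact fun p hp => ⟨hp.1, hX hp.1 (heval hp.2)⟩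
  let f : J.restrictScalars R →ₗ[R] A :=
    ((leval (0 : R)).comp (J.restrictScalars R).subtype).codRestrict A fun p =>
      hmap ▸ Ideal.mem_map_of_mem (evalRingHom (0 : R)) p.2
  have hf : Function.Surjective f := fun a =>
    ⟨⟨C a.1, hAJ (Ideal.mem_map_of_mem C a.2)⟩, Subtype.ext eval_C⟩
  have hker : (Submodule.restrictScalars R (J ⊓ (Ideal.span {X} * B))).comap
      (J.restrictScalars R).subtype = LinearMap.ker f := by
    ext p
    refine ⟨fun hp => Subtype.ext (heval (Ideal.mul_le_left hp.2)), fun hp => ?_⟩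
    exact ⟨p.2, hX p.2 (congrArg Subtype.val hp)⟩
  exact ⟨(Submodule.quotEquivOfEq _ _ hker).trans (f.quotKerEquivOfSurjective hf),
    fun p hp => rfl⟩
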